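/- arXiv:1303.1996 — 2 statements merged into one kernel-verified Lean document; each statement's English description precedes it below -/
import Mathlib

section
/- Let T > 0, ν > 0. Let ω : ℝ² × [0,T] → ℝ be smooth and bounded with bounded spatial gradient, and let u = ū + u' where ū, u' : ℝ² × [0,T] → ℝ² are smooth, ū has bounded spatial derivatives and u' is bounded. Let φ₁, φ₂ : ℝ² × [0,T] → ℝ be smooth, with φ₁(·,t) and φ₂(·,t) supported in a fixed compact subset of ℝ² for all t, satisfying the dual adjoint system −∂ₜφ₁ − u·∇φ₁ − φ₂ − νΔφ₁ = 0 and −Δφ₂ = rot φ₁ · ∇ω pointwise on ℝ² × [0,T], with terminal condition φ₁(·,T) = ξ₀. Define J := sup_{t∈[0,T]} ( sup_{x∈ℝ²} √((∂₁ū₁ − ∂₂ū₂)² + (∂₂ū₁ + ∂₁ū₂)²)(x,t) + ν⁻¹ sup_{x∈ℝ²} |u'(x,t)|² ). Then for every t* ∈ [0,T], ‖∇φ₁(·,t*)‖²_{L²(ℝ²)} + ν ∫_{t*}^T ‖Δφ₁(·,s)‖²_{L²(ℝ²)} ds ≤ e^{2J(T−t*)} ‖∇ξ₀‖²_{L²(ℝ²)}.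 -/
open MeasureTheory Matrix Set

noncomputable section

/-- The plane `ℝ²` with the Euclidean structure. -/
abbrev E2 := EuclideanSpace ℝ (Fin 2)

/-- Partial derivative `∂ᵢ f` of a scalar function on `ℝ²`. -/
def pd (i : Fin 2) (f : E2 → ℝ) (x : E2) : ℝ :=
  fderiv ℝ f x (EuclideanSpace.single i 1)

/-- The Laplacian `Δ f = ∂₁∂₁ f + ∂₂∂₂ f`. -/
def lap (f : E2 → ℝ) (x : E2) : ℝ :=
  pd 0 (pd 0 f) x + pd 1 (pd 1 f) x

/-- The rotated gradient `rot ψ = (∂₂ψ, −∂₁ψ)`. -/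
def rotv (f : E2 → ℝ) (x : E2) : Fin 2 → ℝ := ![pd 1 f x, -(pd 0 f x)]

/-- The gradient `∇f = (∂₁f, ∂₂f)` as a plain vector. -/
def grad2 (f : E2 → ℝ) (x : E2) : Fin 2 → ℝ := ![pd 0 f x, pd 1 f x]

/-- The Jacobian matrix `(∇u)ᵢⱼ = ∂ⱼ uᵢ` of a vector field. -/
def gradMat (u : E2 → Fin 2 → ℝ) (x : E2) : Matrix (Fin 2) (Fin 2) ℝ :=
  Matrix.of fun i j => pd j (fun y => u y i) x

/-- The divergence `∇·u = ∂₁u₁ + ∂₂u₂` of a vector field. -/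
def divg (u : E2 → Fin 2 → ℝ) (x : E2) : ℝ :=
  pd 0 (fun y => u y 0) x + pd 1 (fun y => u y 1) x

section

open scoped ContDiff

lemma contDiff_fderiv_apply {E : Type*} [NormedAddCommGroup E] [NormedSpace ℝ E] {f : E → ℝ}
    (hf : ContDiff ℝ ∞ f) (v : E) : ContDiff ℝ ∞ (fun x => fderiv ℝ f x v) :=
  (hf.fderiv_right (m := ∞) (by simp)).clm_apply contDiff_const

lemma fderiv_fderiv_apply_comm {E : Type*} [NormedAddCommGroup E] [NormedSpace ℝ E] {f : E → ℝ}
    (hf : ContDiff ℝ ∞ f) (v w x : E) :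
    fderiv ℝ (fun y => fderiv ℝ f y v) x w = fderiv ℝ (fun y => fderiv ℝ f y w) x v := by
  have hd : DifferentiableAt ℝ (fderiv ℝ f) x :=
    (hf.fderiv_right (m := ∞) (by simp)).differentiable (by simp) x
  have hs : IsSymmSndFDerivAt ℝ f x :=
    hf.contDiffAt.isSymmSndFDerivAt (by
    rw [minSmoothness_of_isRCLikeNormedField]
    exact WithTop.coe_le_coe.mpr le_top)
  rw [fderiv_clm_apply hd (differentiableAt_const v), fderiv_clm_apply hd (differentiableAt_const w)]
  simpa using hs w v

lemma contDiff_pd {f : E2 → ℝ} (hf : ContDiff ℝ ∞ f) (i : Fin 2) : ContDiff ℝ ∞ (pd i f) :=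
  contDiff_fderiv_apply hf _

lemma pd_comm {f : E2 → ℝ} (hf : ContDiff ℝ ∞ f) (i j : Fin 2) (x : E2) :
    pd i (pd j f) x = pd j (pd i f) x :=
  fderiv_fderiv_apply_comm hf _ _ x

lemma pd_add {f g : E2 → ℝ} {x : E2} (i : Fin 2) (hf : DifferentiableAt ℝ f x)
    (hg : DifferentiableAt ℝ g x) : pd i (fun y => f y + g y) x = pd i f x + pd i g x := by
  simp [pd, fderiv_fun_add hf hg]

lemma pd_sub {f g : E2 → ℝ} {x : E2} (i : Fin 2) (hf : DifferentiableAt ℝ f x)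
    (hg : DifferentiableAt ℝ g x) : pd i (fun y => f y - g y) x = pd i f x - pd i g x := by
  simp [pd, fderiv_fun_sub hf hg]

lemma pd_mul {f g : E2 → ℝ} {x : E2} (i : Fin 2) (hf : DifferentiableAt ℝ f x)
    (hg : DifferentiableAt ℝ g x) :
    pd i (fun y => f y * g y) x = f x * pd i g x + g x * pd i f x := by
  simp [pd, fderiv_fun_mul hf hg]

lemma pd_eq_zero_of_notMem_tsupport {f : E2 → ℝ} {x : E2} (hx : x ∉ tsupport f) (i : Fin 2) :
    pd i f x = 0 := by
  simp [pd, fderiv_of_notMem_tsupport (𝕜 := ℝ) hx]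

lemma tsupport_pd_subset (f : E2 → ℝ) (i : Fin 2) : tsupport (pd i f) ⊆ tsupport f :=
  closure_minimal (fun _ hx => by_contra fun h => hx (pd_eq_zero_of_notMem_tsupport h i))
    (isClosed_tsupport f)

lemma pd_pd_eq_zero_of_notMem_tsupport {f : E2 → ℝ} {x : E2} (hx : x ∉ tsupport f)
    (i j : Fin 2) : pd i (pd j f) x = 0 :=
  pd_eq_zero_of_notMem_tsupport (fun h => hx (tsupport_pd_subset f j h)) i

lemma integrable_pd {f : E2 → ℝ} (hf : ContDiff ℝ ∞ f) (hc : HasCompactSupport f) (i : Fin 2) :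
    Integrable (pd i f) :=
  (contDiff_pd hf i).continuous.integrable_of_hasCompactSupport
    (hc.mono' ((subset_tsupport _).trans (tsupport_pd_subset f i)))

lemma integral_pd_eq_zero {f : E2 → ℝ} (hf : ContDiff ℝ ∞ f) (hc : HasCompactSupport f)
    (i : Fin 2) : ∫ x, pd i f x = 0 := by
  have h := integral_mul_fderiv_eq_neg_fderiv_mul_of_integrable (μ := (volume : Measure E2))
    (f := fun _ => (1 : ℝ)) (g := f) (v := EuclideanSpace.single i 1)
    (by simp) (by simpa [pd] using! integrable_pd hf hc i)
    (by simpa using hf.continuous.integrable_of_hasCompactSupport hc)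
    (fun x _ => by fun_prop) (fun x _ => hf.differentiable (by simp) x)
  simpa [pd] using h

/-- The traceless symmetric matrix with rows `(p, q)` and `(q, -p)` has spectral radius
`√(p² + q²)`. -/
lemma deviatoric_quadratic_le {p q A : ℝ} (h : Real.sqrt (p ^ 2 + q ^ 2) ≤ A) (a b : ℝ) :
    p * (a ^ 2 - b ^ 2) + 2 * q * (a * b) ≤ A * (a ^ 2 + b ^ 2) := by
  have hab : 0 ≤ a ^ 2 + b ^ 2 := by positivity
  refine le_trans ?_ (mul_le_mul_of_nonneg_right h hab)
  refine le_of_sq_le_sq ?_ (by positivity)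
  rw [mul_pow, Real.sq_sqrt (by positivity)]
  nlinarith [sq_nonneg (p * (2 * (a * b)) - q * (a ^ 2 - b ^ 2))]

/-- Young's inequality for `2 l (c · (a, b))`. -/
lemma neg_two_mul_le_young {ν B c d : ℝ} (hν : 0 < ν) (h : c ^ 2 + d ^ 2 ≤ B) (l a b : ℝ) :
    -(2 * l * (c * a + d * b)) ≤ ν * l ^ 2 + ν⁻¹ * B * (a ^ 2 + b ^ 2) := by
  have hab : 0 ≤ a ^ 2 + b ^ 2 := by positivity
  have h1 : (c * a + d * b) ^ 2 ≤ B * (a ^ 2 + b ^ 2) := by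
    nlinarith [sq_nonneg (c * b - d * a), mul_le_mul_of_nonneg_right h hab]
  have h2 : 0 ≤ ν * (l + ν⁻¹ * (c * a + d * b)) ^ 2 := by positivity
  have h3 : ν * (l + ν⁻¹ * (c * a + d * b)) ^ 2
      = ν * l ^ 2 + 2 * l * (c * a + d * b) + ν⁻¹ * (c * a + d * b) ^ 2 := by
    field_simp
    ring
  have h4 := mul_le_mul_of_nonneg_left h1 (inv_nonneg.mpr hν.le)
  linarith

/-- The energy inequality at a fixed time. -/
lemma energy_inequality {ν A B : ℝ} (hν : 0 < ν) {g f o ψ w₀ w₁ v₀ v₁ : E2 → ℝ}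
    (hg : ContDiff ℝ ∞ g) (hf : ContDiff ℝ ∞ f) (ho : ContDiff ℝ ∞ o) (hψ : ContDiff ℝ ∞ ψ)
    (hw₀ : ContDiff ℝ ∞ w₀) (hw₁ : ContDiff ℝ ∞ w₁) (hgc : HasCompactSupport g)
    (heq1 : ∀ x, -ψ x - ((w₀ x + v₀ x) * pd 0 g x + (w₁ x + v₁ x) * pd 1 g x)
      - f x - ν * lap g x = 0)
    (heq2 : ∀ x, -(lap f x) = pd 1 g x * pd 0 o x - pd 0 g x * pd 1 o x)
    (hA : ∀ x, Real.sqrt ((pd 0 w₀ x - pd 1 w₁ x) ^ 2 + (pd 1 w₀ x + pd 0 w₁ x) ^ 2) ≤ A)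
    (hB : ∀ x, v₀ x ^ 2 + v₁ x ^ 2 ≤ B) :
    ν * ∫ x, lap g x ^ 2 ≤ (A + ν⁻¹ * B) * (∫ x, (pd 0 g x ^ 2 + pd 1 g x ^ 2))
      + ∫ x, (2 * (pd 0 g x * pd 0 ψ x) + 2 * (pd 1 g x * pd 1 ψ x)) := by
  have hp0 := contDiff_pd hg 0
  have hp1 := contDiff_pd hg 1
  have hq0 := contDiff_pd hf 0
  have hq1 := contDiff_pd hf 1
  have hr0 := contDiff_pd ho 0
  have hr1 := contDiff_pd ho 1
  have hs0 := contDiff_pd hψ 0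
  have hs1 := contDiff_pd hψ 1
  have ht0 := contDiff_pd hp0 0
  have ht1 := contDiff_pd hp1 1
  let X₀ : E2 → ℝ := fun x => 2 * (pd 0 g x * ψ x)
    + 2 * (pd 0 g x * (w₀ x * pd 0 g x + w₁ x * pd 1 g x))
    - w₀ x * (pd 0 g x * pd 0 g x + pd 1 g x * pd 1 g x)
    + 2 * (pd 0 g x * f x - g x * pd 0 f x) + g x * g x * pd 1 o x
  let X₁ : E2 → ℝ := fun x => 2 * (pd 1 g x * ψ x)
    + 2 * (pd 1 g x * (w₀ x * pd 0 g x + w₁ x * pd 1 g x))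
    - w₁ x * (pd 0 g x * pd 0 g x + pd 1 g x * pd 1 g x)
    + 2 * (pd 1 g x * f x - g x * pd 1 f x) - g x * g x * pd 0 o x
  have hX₀ : ContDiff ℝ ∞ X₀ := by fun_prop
  have hX₁ : ContDiff ℝ ∞ X₁ := by fun_prop
  have hX₀c : HasCompactSupport X₀ := HasCompactSupport.intro hgc fun x hx => by
    simp [X₀, pd_eq_zero_of_notMem_tsupport hx, image_eq_zero_of_notMem_tsupport hx]
  have hX₁c : HasCompactSupport X₁ := HasCompactSupport.intro hgc fun x hx => by
    simp [X₁, pd_eq_zero_of_notMem_tsupport hx, image_eq_zero_of_notMem_tsupport hx]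
  have hl : Integrable fun x => lap g x ^ 2 := by
    refine Continuous.integrable_of_hasCompactSupport ?_ ?_
    · have := ht0.continuous
      have := ht1.continuous
      unfold lap
      fun_prop
    · exact HasCompactSupport.intro hgc fun x hx => by
        simp [lap, pd_pd_eq_zero_of_notMem_tsupport hx]
  have hG : Integrable fun x => pd 0 g x ^ 2 + pd 1 g x ^ 2 := by
    refine Continuous.integrable_of_hasCompactSupport ?_ ?_
    · have := hp0.continuous
      have := hp1.continuous
      fun_prop
    · exact HasCompactSupport.intro hgc fun x hx => by
        simp [pd_eq_zero_of_notMem_tsupport hx]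
  have hD : Integrable fun x => 2 * (pd 0 g x * pd 0 ψ x) + 2 * (pd 1 g x * pd 1 ψ x) := by
    refine Continuous.integrable_of_hasCompactSupport ?_ ?_
    · have := hp0.continuous
      have := hp1.continuous
      have := hs0.continuous
      have := hs1.continuous
      fun_prop
    · exact HasCompactSupport.intro hgc fun x hx => by
        simp [pd_eq_zero_of_notMem_tsupport hx]
  have hpt : ∀ x, ν * lap g x ^ 2 + (pd 0 X₀ x + pd 1 X₁ x)
      ≤ (A + ν⁻¹ * B) * (pd 0 g x ^ 2 + pd 1 g x ^ 2)
        + (2 * (pd 0 g x * pd 0 ψ x) + 2 * (pd 1 g x * pd 1 ψ x)) := by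
    intro x
    have d1 := hg.differentiable (by simp) x
    have d2 := hf.differentiable (by simp) x
    have d3 := hψ.differentiable (by simp) x
    have d4 := hw₀.differentiable (by simp) x
    have d5 := hw₁.differentiable (by simp) x
    have d6 := hp0.differentiable (by simp) x
    have d7 := hp1.differentiable (by simp) x
    have d8 := hq0.differentiable (by simp) x
    have d9 := hq1.differentiable (by simp) x
    have d10 := hr0.differentiable (by simp) x
    have d11 := hr1.differentiable (by simp) x
    have hc : pd 0 (fun _ => (2 : ℝ)) x = 0 ∧ pd 1 (fun _ => (2 : ℝ)) x = 0 := by simp [pd]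
    have e0 : pd 0 X₀ x = 2 * (pd 0 g x * pd 0 ψ x + ψ x * pd 0 (pd 0 g) x)
        + 2 * (pd 0 g x * (w₀ x * pd 0 (pd 0 g) x + pd 0 g x * pd 0 w₀ x
            + (w₁ x * pd 0 (pd 1 g) x + pd 1 g x * pd 0 w₁ x))
          + (w₀ x * pd 0 g x + w₁ x * pd 1 g x) * pd 0 (pd 0 g) x)
        - (w₀ x * (2 * pd 0 g x * pd 0 (pd 0 g) x + 2 * pd 1 g x * pd 0 (pd 1 g) x)
          + (pd 0 g x * pd 0 g x + pd 1 g x * pd 1 g x) * pd 0 w₀ x)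
        + 2 * (f x * pd 0 (pd 0 g) x - g x * pd 0 (pd 0 f) x)
        + (g x * g x * pd 0 (pd 1 o) x + 2 * g x * pd 0 g x * pd 1 o x) := by
      simp (disch := fun_prop) only [X₀, pd_add, pd_sub, pd_mul, hc]
      ring
    have e1 : pd 1 X₁ x = 2 * (pd 1 g x * pd 1 ψ x + ψ x * pd 1 (pd 1 g) x)
        + 2 * (pd 1 g x * (w₀ x * pd 1 (pd 0 g) x + pd 0 g x * pd 1 w₀ x
            + (w₁ x * pd 1 (pd 1 g) x + pd 1 g x * pd 1 w₁ x))
          + (w₀ x * pd 0 g x + w₁ x * pd 1 g x) * pd 1 (pd 1 g) x)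
        - (w₁ x * (2 * pd 0 g x * pd 1 (pd 0 g) x + 2 * pd 1 g x * pd 1 (pd 1 g) x)
          + (pd 0 g x * pd 0 g x + pd 1 g x * pd 1 g x) * pd 1 w₁ x)
        + 2 * (f x * pd 1 (pd 1 g) x - g x * pd 1 (pd 1 f) x)
        - (g x * g x * pd 1 (pd 0 o) x + 2 * g x * pd 1 g x * pd 0 o x) := by
      simp (disch := fun_prop) only [X₁, pd_add, pd_sub, pd_mul, hc]
      ring
    have hψx : ψ x = -((w₀ x + v₀ x) * pd 0 g x + (w₁ x + v₁ x) * pd 1 g x)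
      - f x - ν * lap g x := by linarith [heq1 x]
    have h1 := deviatoric_quadratic_le (hA x) (pd 0 g x) (pd 1 g x)
    have h2 := neg_two_mul_le_young hν (hB x) (lap g x) (pd 0 g x) (pd 1 g x)
    have h3 : g x * (pd 0 (pd 0 f) x + pd 1 (pd 1 f) x)
        = -(g x * (pd 1 g x * pd 0 o x - pd 0 g x * pd 1 o x)) := by
      rw [← heq2 x, lap]
      ring
    rw [e0, e1, pd_comm hg 1 0, pd_comm ho 1 0, hψx]
    unfold lap at h2 ⊢
    linarith
  have hX₀i := integrable_pd hX₀ hX₀c 0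
  have hX₁i := integrable_pd hX₁ hX₁c 1
  have key := integral_mono ((hl.const_mul ν).add (hX₀i.add hX₁i))
    ((hG.const_mul (A + ν⁻¹ * B)).add hD) hpt
  rw [integral_add' (hl.const_mul ν) (hX₀i.add hX₁i), integral_add' (hG.const_mul _) hD,
    integral_add' hX₀i hX₁i, integral_pd_eq_zero hX₀ hX₀c,
    integral_pd_eq_zero hX₁ hX₁c, integral_const_mul, integral_const_mul] at key
  linarith

lemma hasDerivAt_uncurry_left {E : Type*} [NormedAddCommGroup E] [NormedSpace ℝ E] {F : ℝ → E → ℝ}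
    (hF : ContDiff ℝ ∞ (fun p : ℝ × E => F p.1 p.2)) (t : ℝ) (x : E) :
    HasDerivAt (fun s => F s x) (fderiv ℝ (fun p : ℝ × E => F p.1 p.2) (t, x) (1, 0)) t :=
  (hF.differentiable (by simp) (t, x)).hasFDerivAt.comp_hasDerivAt_of_eq t
    ((hasDerivAt_id t).prodMk (hasDerivAt_const t x)) rfl

lemma contDiff_deriv_uncurry_left {E : Type*} [NormedAddCommGroup E] [NormedSpace ℝ E]
    {F : ℝ → E → ℝ} (hF : ContDiff ℝ ∞ (fun p : ℝ × E => F p.1 p.2)) :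
    ContDiff ℝ ∞ (fun p : ℝ × E => deriv (fun s => F s p.2) p.1) := by
  simp_rw [fun p : ℝ × E => (hasDerivAt_uncurry_left hF p.1 p.2).deriv]
  exact contDiff_fderiv_apply hF _

/-- Differentiation under the integral sign over a compact set. -/
lemma hasDerivAt_setIntegral_of_contDiff {E : Type*} [NormedAddCommGroup E] [NormedSpace ℝ E]
    [MeasurableSpace E] [OpensMeasurableSpace E] {μ : Measure E} [IsLocallyFiniteMeasure μ]
    {F : ℝ → E → ℝ} (hF : ContDiff ℝ ∞ (fun p : ℝ × E => F p.1 p.2)) {K : Set E}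
    (hK : IsCompact K) (t : ℝ) :
    HasDerivAt (fun t => ∫ x in K, F t x ∂μ) (∫ x in K, deriv (fun s => F s x) t ∂μ) t := by
  have hF' := (contDiff_deriv_uncurry_left hF).continuous
  have hslice : ∀ s, Continuous (F s) := fun s =>
    hF.continuous.comp (Continuous.prodMk_right s)
  obtain ⟨C, hC⟩ := ((isCompact_Icc (a := t - 1) (b := t + 1)).prod hK).exists_bound_of_continuousOn
    hF'.continuousOn
  refine (hasDerivAt_integral_of_dominated_loc_of_deriv_le (s := Icc (t - 1) (t + 1))
    (F' := fun s x => deriv (fun r => F r x) s) (bound := fun _ => C)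
    (Icc_mem_nhds (by linarith) (by linarith))
    (Filter.Eventually.of_forall fun s =>
      ((hslice s).continuousOn.integrableOn_compact hK).aestronglyMeasurable)
    ((hslice t).continuousOn.integrableOn_compact hK)
    ((hF'.comp (Continuous.prodMk_right t)).continuousOn.integrableOn_compact
      hK).aestronglyMeasurable
    ?_ (integrableOn_const hK.measure_lt_top.ne) ?_).2
  · exact ae_restrict_of_forall_mem hK.measurableSet fun x hx s hs => hC (s, x) ⟨hs, hx⟩
  · exact Filter.Eventually.of_forall fun x s _ =>
      (hasDerivAt_uncurry_left hF s x).differentiableAt.hasDerivAt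

lemma pd_eq_fderiv_uncurry {φ : ℝ → E2 → ℝ}
    (hφ : ContDiff ℝ ∞ (fun p : ℝ × E2 => φ p.1 p.2)) (i : Fin 2) (t : ℝ) (x : E2) :
    pd i (φ t) x
      = fderiv ℝ (fun p : ℝ × E2 => φ p.1 p.2) (t, x) (0, EuclideanSpace.single i 1) := by
  have h := (hφ.differentiable (by simp) (t, x)).hasFDerivAt.comp x (hasFDerivAt_prodMk_right t x)
  have h' : fderiv ℝ (φ t) x = _ := h.fderiv
  simp [pd, h']

lemma contDiff_pd_uncurry {φ : ℝ → E2 → ℝ}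
    (hφ : ContDiff ℝ ∞ (fun p : ℝ × E2 => φ p.1 p.2)) (i : Fin 2) :
    ContDiff ℝ ∞ (fun p : ℝ × E2 => pd i (φ p.1) p.2) := by
  simp_rw [pd_eq_fderiv_uncurry hφ]
  exact contDiff_fderiv_apply hφ _

lemma hasDerivAt_pd {φ : ℝ → E2 → ℝ} (hφ : ContDiff ℝ ∞ (fun p : ℝ × E2 => φ p.1 p.2))
    (i : Fin 2) (t : ℝ) (x : E2) :
    HasDerivAt (fun s => pd i (φ s) x) (pd i (fun y => deriv (fun s => φ s y) t) x) t := by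
  convert hasDerivAt_uncurry_left (F := fun s => pd i (φ s)) (contDiff_pd_uncurry hφ i) t x using 1
  rw [pd_eq_fderiv_uncurry (φ := fun r y => deriv (fun s => φ s y) r)
    (contDiff_deriv_uncurry_left hφ)]
  simp_rw [fun p : ℝ × E2 => (hasDerivAt_uncurry_left hφ p.1 p.2).deriv, pd_eq_fderiv_uncurry hφ]
  exact fderiv_fderiv_apply_comm hφ _ _ _

/-- A backward Grönwall inequality with a dissipation term. -/
lemma backward_gronwall {G G' L : ℝ → ℝ} {ν J a b : ℝ} (hν : 0 ≤ ν) (hJ : 0 ≤ J) (hab : a ≤ b)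
    (hG : ∀ t, HasDerivAt G (G' t) t) (hL : Continuous L) (hL0 : ∀ t, 0 ≤ L t)
    (h : ∀ t ∈ Ioo a b, ν * L t ≤ J * G t + G' t) :
    G a + ν * ∫ s in a..b, L s ≤ Real.exp (J * (b - a)) * G b := by
  have hd : ∀ t, HasDerivAt (fun t => Real.exp (J * (t - a)) * G t - ν * ∫ s in a..t, L s)
      (Real.exp (J * (t - a)) * (J * G t + G' t) - ν * L t) t := by
    intro t
    have h1 : HasDerivAt (fun t => Real.exp (J * (t - a))) (Real.exp (J * (t - a)) * J) t := by
      simpa using (((hasDerivAt_id t).sub_const a).const_mul J).exp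
    have h2 := (hL.integral_hasStrictDerivAt a t).hasDerivAt
    refine ((h1.mul (hG t)).sub (h2.const_mul ν)).congr_deriv ?_
    ring
  have hm : MonotoneOn (fun t => Real.exp (J * (t - a)) * G t - ν * ∫ s in a..t, L s)
      (Icc a b) := by
    refine monotoneOn_of_deriv_nonneg (convex_Icc a b)
      (fun t _ => (hd t).continuousAt.continuousWithinAt)
      (fun t _ => (hd t).differentiableAt.differentiableWithinAt) fun t ht => ?_
    rw [interior_Icc] at ht
    rw [(hd t).deriv]
    have h1 : 1 ≤ Real.exp (J * (t - a)) :=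
      Real.one_le_exp (mul_nonneg hJ (sub_nonneg.mpr ht.1.le))
    have h2 : 0 ≤ ν * L t := mul_nonneg hν (hL0 t)
    have h3 := mul_le_mul_of_nonneg_left (h t ht) (zero_le_one.trans h1)
    nlinarith
  have := hm (left_mem_Icc.mpr hab) (right_mem_Icc.mpr hab) hab
  simp only [sub_self, mul_zero, Real.exp_zero, one_mul, intervalIntegral.integral_same,
    sub_zero] at this
  linarith

end

/-- stability estimate for the first dual variable `φ₁` of the dual adjoint
problem of the 2D Navier–Stokes equations in vorticity–stream function form:
`‖∇φ₁(·,t*)‖² + ν ∫_{t*}^T ‖Δφ₁‖² ≤ e^{2J(T−t*)} ‖∇ξ₀‖²`. -/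
theorem dual_stability_phi1 (T ν : ℝ) (hT : 0 < T) (hν : 0 < ν)
    (ω : ℝ → E2 → ℝ)
    (hω : ContDiff ℝ (⊤ : ℕ∞) (fun p : ℝ × E2 => ω p.1 p.2))
    (hωb : ∃ C, ∀ (t : ℝ) (x : E2), |ω t x| ≤ C)
    (hωg : ∃ C, ∀ (t : ℝ) (x : E2) (i : Fin 2), |pd i (ω t) x| ≤ C)
    (ubar u' : ℝ → E2 → Fin 2 → ℝ)
    (hubar : ContDiff ℝ (⊤ : ℕ∞) (fun p : ℝ × E2 => ubar p.1 p.2))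
    (hu' : ContDiff ℝ (⊤ : ℕ∞) (fun p : ℝ × E2 => u' p.1 p.2))
    (hubarD : ∃ C, ∀ (t : ℝ) (x : E2) (i j : Fin 2), |gradMat (ubar t) x i j| ≤ C)
    (hu'b : ∃ C, ∀ (t : ℝ) (x : E2) (i : Fin 2), |u' t x i| ≤ C)
    (u : ℝ → E2 → Fin 2 → ℝ) (hu : ∀ t x, u t x = ubar t x + u' t x)
    (φ₁ φ₂ : ℝ → E2 → ℝ)
    (hφ₁ : ContDiff ℝ (⊤ : ℕ∞) (fun p : ℝ × E2 => φ₁ p.1 p.2))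
    (hφ₂ : ContDiff ℝ (⊤ : ℕ∞) (fun p : ℝ × E2 => φ₂ p.1 p.2))
    (hsupp : ∃ K : Set E2, IsCompact K ∧
      ∀ t ∈ Set.Icc (0 : ℝ) T, tsupport (φ₁ t) ⊆ K ∧ tsupport (φ₂ t) ⊆ K)
    (heq1 : ∀ t ∈ Set.Icc (0 : ℝ) T, ∀ x : E2,
      -(deriv (fun s => φ₁ s x) t) - (∑ i, u t x i * pd i (φ₁ t) x)
        - φ₂ t x - ν * lap (φ₁ t) x = 0)
    (heq2 : ∀ t ∈ Set.Icc (0 : ℝ) T, ∀ x : E2,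
      -(lap (φ₂ t) x) = rotv (φ₁ t) x ⬝ᵥ grad2 (ω t) x)
    (ξ₀ : E2 → ℝ) (hξ : ∀ x : E2, φ₁ T x = ξ₀ x)
    (J : ℝ)
    (hJ : J = ⨆ t : Set.Icc (0 : ℝ) T,
      ((⨆ x : E2, Real.sqrt
          ((gradMat (ubar (t : ℝ)) x 0 0 - gradMat (ubar (t : ℝ)) x 1 1) ^ 2
            + (gradMat (ubar (t : ℝ)) x 0 1 + gradMat (ubar (t : ℝ)) x 1 0) ^ 2))
        + ν⁻¹ * ⨆ x : E2, ((u' (t : ℝ) x 0) ^ 2 + (u' (t : ℝ) x 1) ^ 2))) :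
    ∀ tstar ∈ Set.Icc (0 : ℝ) T,
      (∫ x : E2, ((pd 0 (φ₁ tstar) x) ^ 2 + (pd 1 (φ₁ tstar) x) ^ 2))
        + ν * ∫ s in tstar..T, ∫ x : E2, (lap (φ₁ s) x) ^ 2
      ≤ Real.exp (2 * J * (T - tstar)) * ∫ x : E2, ((pd 0 ξ₀ x) ^ 2 + (pd 1 ξ₀ x) ^ 2) := by
  obtain ⟨K, hK, hKs⟩ := hsupp
  obtain ⟨C, hC⟩ := hubarD
  obtain ⟨D, hD⟩ := hu'b
  have hslice : ∀ {f : ℝ → E2 → ℝ}, ContDiff ℝ (⊤ : ℕ∞) (fun p : ℝ × E2 => f p.1 p.2) →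
      ∀ t, ContDiff ℝ (⊤ : ℕ∞) (f t) := fun hf t => hf.comp (contDiff_prodMk_right t)
  have hub : ∀ i t, ContDiff ℝ (⊤ : ℕ∞) (fun x => ubar t x i) := fun i t =>
    hslice (f := fun t x => ubar t x i) (contDiff_pi.mp hubar i) t
  let S : ℝ → E2 → ℝ := fun t x => Real.sqrt
    ((gradMat (ubar t) x 0 0 - gradMat (ubar t) x 1 1) ^ 2
      + (gradMat (ubar t) x 0 1 + gradMat (ubar t) x 1 0) ^ 2)
  let V : ℝ → E2 → ℝ := fun t x => u' t x 0 ^ 2 + u' t x 1 ^ 2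
  have hSb : ∀ t x, S t x ≤ Real.sqrt ((2 * C) ^ 2 + (2 * C) ^ 2) := by
    intro t x
    refine Real.sqrt_le_sqrt (add_le_add ?_ ?_) <;> refine sq_le_sq' ?_ ?_ <;>
    linarith [abs_le.mp (hC t x 0 0), abs_le.mp (hC t x 1 1), abs_le.mp (hC t x 0 1),
      abs_le.mp (hC t x 1 0)]
  have hVb : ∀ t x, V t x ≤ D ^ 2 + D ^ 2 := fun t x =>
    add_le_add (sq_le_sq' (abs_le.mp (hD t x 0)).1 (abs_le.mp (hD t x 0)).2)
      (sq_le_sq' (abs_le.mp (hD t x 1)).1 (abs_le.mp (hD t x 1)).2)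
  have hSbdd : ∀ t, BddAbove (range (S t)) := fun t => ⟨_, forall_mem_range.mpr (hSb t)⟩
  have hVbdd : ∀ t, BddAbove (range (V t)) := fun t => ⟨_, forall_mem_range.mpr (hVb t)⟩
  have hJle : ∀ t ∈ Icc (0 : ℝ) T, (⨆ x, S t x) + ν⁻¹ * (⨆ x, V t x) ≤ J := by
    intro t ht
    rw [hJ]
    refine le_ciSup (f := fun t : Icc (0 : ℝ) T => (⨆ x, S t x) + ν⁻¹ * ⨆ x, V t x) ?_ ⟨t, ht⟩
    exact ⟨_, forall_mem_range.mpr fun s => add_le_add (ciSup_le (hSb s))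
      (mul_le_mul_of_nonneg_left (ciSup_le (hVb s)) (inv_nonneg.mpr hν.le))⟩
  have hJ0 : 0 ≤ J := by
    refine le_trans ?_ (hJle 0 (left_mem_Icc.mpr hT.le))
    exact add_nonneg (Real.iSup_nonneg fun x => Real.sqrt_nonneg _)
      (mul_nonneg (inv_nonneg.mpr hν.le) (Real.iSup_nonneg fun x => by positivity))
  have hout : ∀ t ∈ Icc (0 : ℝ) T, ∀ x ∉ K, x ∉ tsupport (φ₁ t) :=
    fun t ht x hx h => hx ((hKs t ht).1 h)
  have hF : ContDiff ℝ (⊤ : ℕ∞) (fun p : ℝ × E2 => pd 0 (φ₁ p.1) p.2 ^ 2 + pd 1 (φ₁ p.1) p.2 ^ 2) :=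
    ((contDiff_pd_uncurry hφ₁ 0).pow 2).add ((contDiff_pd_uncurry hφ₁ 1).pow 2)
  have hFd : ∀ t x, deriv (fun s => pd 0 (φ₁ s) x ^ 2 + pd 1 (φ₁ s) x ^ 2) t
      = 2 * (pd 0 (φ₁ t) x * pd 0 (fun y => deriv (fun s => φ₁ s y) t) x)
        + 2 * (pd 1 (φ₁ t) x * pd 1 (fun y => deriv (fun s => φ₁ s y) t) x) := by
    intro t x
    refine ((((hasDerivAt_pd hφ₁ 0 t x).pow 2).add
      ((hasDerivAt_pd hφ₁ 1 t x).pow 2)).congr_deriv ?_).deriv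
    push_cast
    ring
  have hGd := hasDerivAt_setIntegral_of_contDiff (μ := (volume : Measure E2))
    (F := fun t x => pd 0 (φ₁ t) x ^ 2 + pd 1 (φ₁ t) x ^ 2) hF hK
  have hLc : Continuous fun t => ∫ x in K, lap (φ₁ t) x ^ 2 := by
    refine continuous_parametric_integral_of_continuous (f := fun t x => lap (φ₁ t) x ^ 2) ?_ hK
    have h0 := contDiff_pd_uncurry (φ := fun t => pd 0 (φ₁ t)) (contDiff_pd_uncurry hφ₁ 0) 0
    have h1 := contDiff_pd_uncurry (φ := fun t => pd 1 (φ₁ t)) (contDiff_pd_uncurry hφ₁ 1) 1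
    exact (h0.continuous.add h1.continuous).pow 2
  have hGK : ∀ t ∈ Icc (0 : ℝ) T, ∫ x in K, (pd 0 (φ₁ t) x ^ 2 + pd 1 (φ₁ t) x ^ 2)
      = ∫ x, (pd 0 (φ₁ t) x ^ 2 + pd 1 (φ₁ t) x ^ 2) := fun t ht =>
    setIntegral_eq_integral_of_forall_compl_eq_zero fun x hx => by
      simp [pd_eq_zero_of_notMem_tsupport (hout t ht x hx)]
  have hLK : ∀ t ∈ Icc (0 : ℝ) T, ∫ x in K, lap (φ₁ t) x ^ 2 = ∫ x, lap (φ₁ t) x ^ 2 :=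
    fun t ht => setIntegral_eq_integral_of_forall_compl_eq_zero fun x hx => by
      simp [lap, pd_pd_eq_zero_of_notMem_tsupport (hout t ht x hx)]
  have hineq : ∀ t ∈ Icc (0 : ℝ) T, ν * (∫ x in K, lap (φ₁ t) x ^ 2)
      ≤ J * (∫ x in K, (pd 0 (φ₁ t) x ^ 2 + pd 1 (φ₁ t) x ^ 2))
        + ∫ x in K, deriv (fun s => pd 0 (φ₁ s) x ^ 2 + pd 1 (φ₁ s) x ^ 2) t := by
    intro t ht
    simp_rw [hFd]
    rw [hGK t ht, hLK t ht, setIntegral_eq_integral_of_forall_compl_eq_zero (fun x hx => by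
      simp [pd_eq_zero_of_notMem_tsupport (hout t ht x hx)])]
    have h := energy_inequality (A := ⨆ x, S t x) (B := ⨆ x, V t x) hν (hslice hφ₁ t)
      (hslice hφ₂ t) (hslice hω t)
      (hslice (f := fun t y => deriv (fun s => φ₁ s y) t) (contDiff_deriv_uncurry_left hφ₁) t)
      (hub 0 t) (hub 1 t) (v₀ := fun x => u' t x 0) (v₁ := fun x => u' t x 1)
      (HasCompactSupport.of_support_subset_isCompact hK
        ((subset_tsupport _).trans (hKs t ht).1))
      (fun x => by simpa [hu] using heq1 t ht x)
      (fun x => by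
        rw [heq2 t ht x]
        simp [rotv, grad2, dotProduct, Fin.sum_univ_two]
        ring)
      (fun x => le_ciSup (hSbdd t) x) (fun x => le_ciSup (hVbdd t) x)
    refine h.trans (add_le_add_left (mul_le_mul_of_nonneg_right (hJle t ht) ?_) _)
    exact integral_nonneg fun x => by positivity
  intro tstar hts
  have hmain := backward_gronwall hν.le hJ0 hts.2 hGd hLc
    (fun t => integral_nonneg fun x => sq_nonneg _)
    (fun t ht => hineq t ⟨hts.1.trans ht.1.le, ht.2.le⟩)
  rw [hGK tstar hts, hGK T (right_mem_Icc.mpr hT.le), show φ₁ T = ξ₀ from funext hξ,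
    intervalIntegral.integral_congr (g := fun s => ∫ x, lap (φ₁ s) x ^ 2) (fun s hs => by
      rw [uIcc_of_le hts.2] at hs
      exact hLK s ⟨hts.1.trans hs.1, hs.2⟩)] at hmain
  refine hmain.trans (mul_le_mul_of_nonneg_right (Real.exp_le_exp.mpr ?_)
    (integral_nonneg fun x => by positivity))
  exact mul_le_mul_of_nonneg_right (by linarith) (sub_nonneg.mpr hts.2)
end
end

section
/- Let A be a real 2×2 matrix, v ∈ ℝ², and ν > 0. Define the symmetric matrix Λ := −½(A + Aᵀ) + ½ (tr A) I₂ + (1/(2ν)) v vᵀ, where I₂ is the 2×2 identity matrix and vvᵀ the outer product. Then every eigenvalue λ of Λ satisfies λ ≤ ½ √((A₁₁ − A₂₂)² + (A₁₂ + A₂₁)²) + |v|²/(2ν), where |v| is the Euclidean norm of v. -/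
open MeasureTheory Matrix Set

noncomputable section

/-- A traceless symmetric quadratic form in the plane, written with coefficients `p` and `q`, is
bounded by the Euclidean length of `(p, q)`. -/
theorem traceless_form_le (p q x y : ℝ) :
    p * (x ^ 2 - y ^ 2) + q * (2 * x * y) ≤ √(p ^ 2 + q ^ 2) * (x ^ 2 + y ^ 2) := by
  refine le_of_abs_le (abs_le_of_sq_le_sq ?_ (by positivity))
  rw [mul_pow, Real.sq_sqrt (by positivity)]
  nlinarith [sq_nonneg (p * (2 * x * y) - q * (x ^ 2 - y ^ 2))]

/-- eigenvalue bound for the stability matrix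
`Λ = −½(A + Aᵀ) + ½(tr A) I₂ + (1/(2ν)) v vᵀ`. -/
theorem eigenvalue_bound_stability_matrix
    (A : Matrix (Fin 2) (Fin 2) ℝ) (v : Fin 2 → ℝ) (ν : ℝ) (hν : 0 < ν)
    (Λ : Matrix (Fin 2) (Fin 2) ℝ)
    (hΛ : Λ = -(((1 : ℝ) / 2) • (A + Aᵀ)) + (((1 : ℝ) / 2) * A.trace) • (1 : Matrix (Fin 2) (Fin 2) ℝ)
        + (1 / (2 * ν)) • Matrix.vecMulVec v v)
    (μ : ℝ) (hμ : ∃ w : Fin 2 → ℝ, w ≠ 0 ∧ Λ.mulVec w = μ • w) :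
    μ ≤ (1 / 2) * Real.sqrt ((A 0 0 - A 1 1) ^ 2 + (A 0 1 + A 1 0) ^ 2)
        + (v 0 ^ 2 + v 1 ^ 2) / (2 * ν) := by
  obtain ⟨w, hw, h⟩ := hμ
  have h0 := congrFun h 0
  have h1 := congrFun h 1
  simp [hΛ, Matrix.mulVec, dotProduct, Fin.sum_univ_two, Matrix.trace, Matrix.vecMulVec_apply]
    at h0 h1
  have hpos : 0 < w 0 ^ 2 + w 1 ^ 2 := by
    by_contra! hle
    refine hw (funext fun i => ?_)
    fin_cases i
    · simpa using (by nlinarith [sq_nonneg (w 0), sq_nonneg (w 1)] : w 0 ^ 2 = 0)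
    · simpa using (by nlinarith [sq_nonneg (w 0), sq_nonneg (w 1)] : w 1 ^ 2 = 0)
  have hform : μ * (w 0 ^ 2 + w 1 ^ 2) =
      (1 / 2) * (-(A 0 0 - A 1 1) * (w 0 ^ 2 - w 1 ^ 2) + -(A 0 1 + A 1 0) * (2 * w 0 * w 1))
        + (v 0 * w 0 + v 1 * w 1) ^ 2 / (2 * ν) := by
    have hdiv : (v 0 * w 0 + v 1 * w 1) ^ 2 / (2 * ν) =
        (v 0 * w 0 + v 1 * w 1) ^ 2 * (ν⁻¹ * 2⁻¹) := by
      rw [div_eq_mul_inv, _root_.mul_inv_rev]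
    rw [hdiv]
    linear_combination -(w 0) * h0 - w 1 * h1
  have htraceless := traceless_form_le (-(A 0 0 - A 1 1)) (-(A 0 1 + A 1 0)) (w 0) (w 1)
  rw [neg_sq, neg_sq] at htraceless
  have hcs : (v 0 * w 0 + v 1 * w 1) ^ 2 / (2 * ν) ≤
      (v 0 ^ 2 + v 1 ^ 2) / (2 * ν) * (w 0 ^ 2 + w 1 ^ 2) := by
    rw [div_mul_eq_mul_div]
    gcongr
    nlinarith [sq_nonneg (v 0 * w 1 - v 1 * w 0)]
  refine le_of_mul_le_mul_right ?_ hpos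
  rw [hform]
  linarith
end
end
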